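/- arXiv:1711.00114 — 4 statements merged into one kernel-verified Lean document; each statement's English description precedes it below -/
import Mathlib

section
/- Let 0 < T < ∞ and let g : (0, T] → ℝ be locally integrable, and define G(t) = ∫_t^T g(s) ds for 0 < t ≤ T. Then for every real number β < 1 one has ∫_0^T t^{-β} G(t)² dt ≤ (4/(1-β)²) ∫_0^T s^{2-β} g(s)² ds, where both sides are interpreted as Lebesgue integrals with values in [0, ∞]. -/
open MeasureTheory Set
open scoped ENNReal

/-- Cauchy–Schwarz for the lower Lebesgue integral. -/
theorem ENNReal.sq_lintegral_mul_le {α : Type*} [MeasurableSpace α] {μ : Measure α}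
    {u v : α → ℝ≥0∞} (hu : AEMeasurable u μ) (hv : AEMeasurable v μ) :
    (∫⁻ x, u x * v x ∂μ) ^ 2 ≤ (∫⁻ x, u x ^ 2 ∂μ) * ∫⁻ x, v x ^ 2 ∂μ := by
  have h := ENNReal.lintegral_mul_le_Lp_mul_Lq μ Real.HolderConjugate.two_two hu hv
  have hsq : ∀ a : ℝ≥0∞, (a ^ (1 / 2 : ℝ)) ^ 2 = a := fun a => by
    rw [← ENNReal.rpow_natCast, ← ENNReal.rpow_mul]
    norm_num
  simp only [Pi.mul_apply, ENNReal.rpow_two] at h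
  calc (∫⁻ x, u x * v x ∂μ) ^ 2
      ≤ ((∫⁻ x, u x ^ 2 ∂μ) ^ (1 / 2 : ℝ) * (∫⁻ x, v x ^ 2 ∂μ) ^ (1 / 2 : ℝ)) ^ 2 := by
        gcongr
    _ = _ := by rw [mul_pow, hsq, hsq]

theorem lintegral_Ioc_rpow_neg_le {c t T : ℝ} (hc : 0 < c) (ht : 0 < t) (htT : t ≤ T) :
    ∫⁻ s in Ioc t T, ENNReal.ofReal (s ^ (-(1 + c))) ≤ ENNReal.ofReal (t ^ (-c) / c) := by
  have h0 : (0 : ℝ) ∉ uIcc t T := by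
    rw [uIcc_of_le htT]
    exact fun h => absurd h.1 (not_le.2 ht)
  have hi : IntervalIntegrable (fun s : ℝ => s ^ (-(1 + c))) volume t T :=
    intervalIntegral.intervalIntegrable_rpow (Or.inr h0)
  rw [← ofReal_integral_eq_lintegral_ofReal ((intervalIntegrable_iff_integrableOn_Ioc_of_le htT).1 hi)
    ((ae_restrict_mem measurableSet_Ioc).mono fun s hs =>
      Real.rpow_nonneg (ht.trans hs.1).le _), ← intervalIntegral.integral_of_le htT,
    integral_rpow (Or.inr ⟨by linarith, h0⟩)]
  apply ENNReal.ofReal_le_ofReal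
  have hT : 0 ≤ T ^ (-c) := Real.rpow_nonneg (ht.le.trans htT) _
  rw [show -(1 + c) + 1 = -c by ring, div_neg, ← neg_div]
  gcongr
  linarith

theorem lintegral_Ioc_zero_rpow {c s : ℝ} (hc : 0 < c) (hs : 0 ≤ s) :
    ∫⁻ t in Ioc 0 s, ENNReal.ofReal (t ^ (c - 1)) = ENNReal.ofReal (s ^ c / c) := by
  have hi : IntervalIntegrable (fun t : ℝ => t ^ (c - 1)) volume 0 s :=
    intervalIntegral.intervalIntegrable_rpow' (by linarith)
  rw [← ofReal_integral_eq_lintegral_ofReal ((intervalIntegrable_iff_integrableOn_Ioc_of_le hs).1 hi)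
    ((ae_restrict_mem measurableSet_Ioc).mono fun t ht => Real.rpow_nonneg ht.1.le _),
    ← intervalIntegral.integral_of_le hs, integral_rpow (Or.inl (by linarith))]
  simp [Real.zero_rpow hc.ne']

/-- Tonelli's theorem on the triangle `0 < t < s ≤ T`. -/
theorem lintegral_Ioc_mul_lintegral_Ioc_le {A h : ℝ → ℝ≥0∞} (hA : Measurable A)
    (hh : Measurable h) (T : ℝ) :
    ∫⁻ t in Ioc 0 T, A t * ∫⁻ s in Ioc t T, h s ≤
      ∫⁻ s in Ioc 0 T, h s * ∫⁻ t in Ioc 0 s, A t := by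
  let k : ℝ → ℝ → ℝ≥0∞ := fun t s => {p : ℝ × ℝ | p.1 < p.2}.indicator
    (fun p => A p.1 * h p.2) (t, s)
  have hk : Measurable (Function.uncurry k) :=
    ((hA.comp measurable_fst).mul (hh.comp measurable_snd)).indicator
      (measurableSet_lt measurable_fst measurable_snd)
  calc ∫⁻ t in Ioc 0 T, A t * ∫⁻ s in Ioc t T, h s
      ≤ ∫⁻ t in Ioc 0 T, ∫⁻ s in Ioc 0 T, k t s := by
        refine setLIntegral_mono' measurableSet_Ioc fun t ht => ?_
        rw [← lintegral_const_mul _ hh]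
        calc ∫⁻ s in Ioc t T, A t * h s = ∫⁻ s in Ioc t T, k t s :=
              setLIntegral_congr_fun measurableSet_Ioc fun s hs => by
                simp [k, hs.1]
          _ ≤ _ := lintegral_mono_set (Ioc_subset_Ioc_left ht.1.le)
    _ = ∫⁻ s in Ioc 0 T, ∫⁻ t in Ioc 0 T, k t s := lintegral_lintegral_swap hk.aemeasurable
    _ ≤ _ := by
        refine setLIntegral_mono' measurableSet_Ioc fun s hs => ?_
        rw [← lintegral_const_mul _ hA, ← lintegral_indicator measurableSet_Ioc,
          ← lintegral_indicator measurableSet_Ioc]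
        refine lintegral_mono fun t => ?_
        by_cases ht : t ∈ Ioc 0 T
        · by_cases hts : t < s
          · simp [k, ht, hts, hts.le, ht.1, mul_comm, indicator]
          · simp [k, ht, hts, indicator]
        · simp [indicator_of_notMem ht]

/-- Hardy's inequality for nonnegative functions. -/
theorem lintegral_hardy {f : ℝ → ℝ≥0∞} (hf : Measurable f) {c : ℝ} (hc : 0 < c) (T : ℝ) :
    ∫⁻ t in Ioc 0 T, ENNReal.ofReal (t ^ (2 * c - 1)) * (∫⁻ s in Ioc t T, f s) ^ 2 ≤
      ENNReal.ofReal (1 / c ^ 2) *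
        ∫⁻ s in Ioc 0 T, ENNReal.ofReal (s ^ (1 + 2 * c)) * f s ^ 2 := by
  have hm : ∀ p : ℝ, Measurable fun s : ℝ => ENNReal.ofReal (s ^ p) := fun p => by fun_prop
  have hmf : Measurable fun s : ℝ => ENNReal.ofReal (s ^ (1 + c)) * f s ^ 2 :=
    (hm _).mul (hf.pow_const 2)
  have key : ∀ t ∈ Ioc 0 T, (∫⁻ s in Ioc t T, f s) ^ 2 ≤
      (∫⁻ s in Ioc t T, ENNReal.ofReal (s ^ (1 + c)) * f s ^ 2) *
        ENNReal.ofReal (t ^ (-c) / c) := fun t ht => by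
    have hsq : ∀ (p s : ℝ), 0 < s →
        ENNReal.ofReal (s ^ (p / 2)) ^ 2 = ENNReal.ofReal (s ^ p) := fun p s hs => by
      rw [← ENNReal.ofReal_pow (by positivity), ← Real.rpow_natCast, ← Real.rpow_mul hs.le]
      norm_num
    have hpos : ∀ s ∈ Ioc t T, 0 < s := fun s hs => ht.1.trans hs.1
    calc (∫⁻ s in Ioc t T, f s) ^ 2
        = (∫⁻ s in Ioc t T, (ENNReal.ofReal (s ^ ((1 + c) / 2)) * f s) *
            ENNReal.ofReal (s ^ (-(1 + c) / 2))) ^ 2 := by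
          congr 1
          refine setLIntegral_congr_fun measurableSet_Ioc fun s hs => ?_
          have hs0 := hpos s hs
          rw [mul_right_comm, ← ENNReal.ofReal_mul (by positivity), ← Real.rpow_add hs0,
            show (1 + c) / 2 + -(1 + c) / 2 = 0 by ring]
          simp
      _ ≤ _ := ENNReal.sq_lintegral_mul_le ((hm _).mul hf).aemeasurable (hm _).aemeasurable
      _ = (∫⁻ s in Ioc t T, ENNReal.ofReal (s ^ (1 + c)) * f s ^ 2) *
            ∫⁻ s in Ioc t T, ENNReal.ofReal (s ^ (-(1 + c))) := by
          congr 1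
          · exact setLIntegral_congr_fun measurableSet_Ioc fun s hs => by
              rw [mul_pow, hsq _ _ (hpos s hs)]
          · exact setLIntegral_congr_fun measurableSet_Ioc fun s hs => hsq _ _ (hpos s hs)
      _ ≤ _ := by
          gcongr
          exact lintegral_Ioc_rpow_neg_le hc ht.1 ht.2
  calc ∫⁻ t in Ioc 0 T, ENNReal.ofReal (t ^ (2 * c - 1)) * (∫⁻ s in Ioc t T, f s) ^ 2
      ≤ ∫⁻ t in Ioc 0 T, (ENNReal.ofReal (1 / c) * ENNReal.ofReal (t ^ (c - 1))) *
          ∫⁻ s in Ioc t T, ENNReal.ofReal (s ^ (1 + c)) * f s ^ 2 := by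
        refine setLIntegral_mono' measurableSet_Ioc fun t ht => ?_
        have ht0 := ht.1
        refine (mul_le_mul_right (key t ht) _).trans_eq ?_
        rw [mul_comm (∫⁻ s in Ioc t T, ENNReal.ofReal (s ^ (1 + c)) * f s ^ 2), ← mul_assoc,
          ← ENNReal.ofReal_mul (by positivity), ← ENNReal.ofReal_mul (by positivity),
          show c - 1 = (2 * c - 1) + -c by ring, Real.rpow_add ht0]
        congr 2
        ring
    _ ≤ _ := lintegral_Ioc_mul_lintegral_Ioc_le ((hm _).const_mul _) hmf T
    _ = ∫⁻ s in Ioc 0 T, ENNReal.ofReal (1 / c ^ 2) *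
          (ENNReal.ofReal (s ^ (1 + 2 * c)) * f s ^ 2) := by
        refine setLIntegral_congr_fun measurableSet_Ioc fun s hs => ?_
        have hs0 := hs.1
        rw [lintegral_const_mul _ (hm _), lintegral_Ioc_zero_rpow hc hs0.le, mul_right_comm,
          ← mul_assoc (ENNReal.ofReal (1 / c ^ 2)), ← ENNReal.ofReal_mul (by positivity),
          ← ENNReal.ofReal_mul (by positivity), ← ENNReal.ofReal_mul (by positivity),
          show 1 + 2 * c = (1 + c) + c by ring, Real.rpow_add hs0 (1 + c) c]
        congr 2
        field_simp
    _ = _ := lintegral_const_mul _ ((hm _).mul (hf.pow_const 2))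

theorem aemeasurable_Ioc_of_integrableOn_Icc {T : ℝ} (hT : 0 < T) {g : ℝ → ℝ}
    (hloc : ∀ a : ℝ, 0 < a → a < T → IntegrableOn g (Icc a T)) :
    AEMeasurable g (volume.restrict (Ioc 0 T)) := by
  have hsub : Ioc 0 T ⊆ ⋃ n : ℕ, Icc (T / (n + 2)) T := fun t ht => by
    obtain ⟨n, hn⟩ := exists_nat_gt (T / t)
    rw [div_lt_iff₀ ht.1] at hn
    refine mem_iUnion.2 ⟨n, ?_, ht.2⟩
    rw [div_le_iff₀ (by positivity)]
    nlinarith [ht.1]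
  refine AEMeasurable.mono_measure ?_ (Measure.restrict_mono_set _ hsub)
  refine aemeasurable_iUnion_iff.2 fun n => (hloc _ (by positivity) ?_).aemeasurable
  rw [div_lt_iff₀ (by positivity)]
  nlinarith [(Nat.cast_nonneg n : (0 : ℝ) ≤ n)]

/-- **Hardy's inequality** (Lemma: special case of the generalized Hardy inequality).
Let `0 < T < ∞`, let `g` be locally integrable on `(0, T]` (i.e. integrable on every
`[a, T]` with `0 < a < T`), and set `G t = ∫_t^T g(s) ds` for `0 < t ≤ T`.  Then for every
`β < 1`,
`∫_0^T t^(-β) G(t)² dt ≤ (4/(1-β)²) ∫_0^T s^(2-β) g(s)² ds`,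
both sides being Lebesgue integrals with values in `[0, ∞]`. -/
theorem hardy_inequality (T : ℝ) (hT : 0 < T) (g : ℝ → ℝ)
    (hloc : ∀ a : ℝ, 0 < a → a < T → IntegrableOn g (Icc a T))
    (G : ℝ → ℝ) (hG : ∀ t ∈ Ioc (0 : ℝ) T, G t = ∫ s in t..T, g s)
    (β : ℝ) (hβ : β < 1) :
    (∫⁻ t in Ioc (0 : ℝ) T, ENNReal.ofReal (t ^ (-β) * (G t) ^ 2))
      ≤ ENNReal.ofReal (4 / (1 - β) ^ 2) *
        ∫⁻ s in Ioc (0 : ℝ) T, ENNReal.ofReal (s ^ (2 - β) * (g s) ^ 2) := by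
  have hg := aemeasurable_Ioc_of_integrableOn_Icc hT hloc
  have hsq : ∀ x : ℝ, ENNReal.ofReal (x ^ 2) = ‖x‖ₑ ^ 2 := fun x => by
    rw [← ofReal_norm, ← ENNReal.ofReal_pow (norm_nonneg x), Real.norm_eq_abs, sq_abs]
  have hc : 0 < (1 - β) / 2 := by linarith
  have hardy := lintegral_hardy (f := fun s => ‖hg.mk g s‖ₑ) hg.measurable_mk.enorm hc T
  rw [show 2 * ((1 - β) / 2) - 1 = -β by ring, show 1 + 2 * ((1 - β) / 2) = 2 - β by ring,
    show 1 / ((1 - β) / 2) ^ 2 = 4 / (1 - β) ^ 2 by rw [div_pow, one_div_div]; norm_num] at hardy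
  calc ∫⁻ t in Ioc (0 : ℝ) T, ENNReal.ofReal (t ^ (-β) * (G t) ^ 2)
      ≤ ∫⁻ t in Ioc 0 T, ENNReal.ofReal (t ^ (-β)) * (∫⁻ s in Ioc t T, ‖hg.mk g s‖ₑ) ^ 2 := by
        refine setLIntegral_mono' measurableSet_Ioc fun t ht => ?_
        rw [ENNReal.ofReal_mul (Real.rpow_nonneg ht.1.le _), hsq, hG t ht,
          intervalIntegral.integral_of_le ht.2]
        gcongr
        refine (enorm_integral_le_lintegral_enorm _).trans_eq (lintegral_congr_ae ?_)
        filter_upwards [ae_restrict_of_ae_restrict_of_subset (Ioc_subset_Ioc_left ht.1.le)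
          hg.ae_eq_mk] with s hs
        rw [hs]
    _ ≤ _ := hardy
    _ = _ := by
        congr 1
        refine lintegral_congr_ae ?_
        filter_upwards [hg.ae_eq_mk, ae_restrict_mem measurableSet_Ioc] with s hs hs'
        rw [ENNReal.ofReal_mul (Real.rpow_nonneg hs'.1.le _), hsq, hs]
end

section
/- Let 0 < T < ∞ and β < 1, and let h : (0, T] → [0, ∞) be continuously differentiable. Then ∫_0^T s^{-β} (h(s) - h(T))² ds ≤ (4/(1-β)²) ∫_0^T s^{2-β} h'(s)² ds, where both sides are interpreted as Lebesgue integrals with values in [0, ∞]. -/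
open MeasureTheory Set
open scoped ENNReal

/-- A truncated Hardy inequality: away from the origin, the boundary term at `ε` has a
favourable sign and can be dropped. -/
theorem intervalIntegral_hardy_le {ε T β : ℝ} (hε : 0 < ε) (hεT : ε ≤ T) (hβ : β < 1)
    {g g' : ℝ → ℝ} (hgT : g T = 0) (hg : ContinuousOn g (Icc ε T))
    (hderiv : ∀ s ∈ Ioo ε T, HasDerivAt g (g' s) s) (hg' : ContinuousOn g' (Icc ε T)) :
    ∫ s in ε..T, s ^ (-β) * g s ^ 2 ≤
      ∫ s in ε..T, 4 / (1 - β) ^ 2 * (s ^ (2 - β) * g' s ^ 2) := by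
  have ha : 0 < 1 - β := by linarith
  have hpos : ∀ s ∈ Icc ε T, 0 < s := fun s hs => hε.trans_le hs.1
  have hpow : ∀ p : ℝ, ContinuousOn (fun s : ℝ => s ^ p) (Icc ε T) := fun p =>
    continuousOn_id.rpow_const fun s hs => Or.inl (hpos s hs).ne'
  have hinteg : ∀ f : ℝ → ℝ, ContinuousOn f (Icc ε T) → IntervalIntegrable f volume ε T :=
    fun f hf => hf.intervalIntegrable_of_Icc hεT
  have hA := hinteg _ ((hpow (-β)).mul (hg.pow 2))
  have hB := hinteg _ (((hpow (2 - β)).mul (hg'.pow 2)).const_mul (4 / (1 - β) ^ 2))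
  have hF := hinteg _ (((((hpow (-β)).const_mul (1 - β)).mul (hg.pow 2)).add
    ((hpow (1 - β)).mul ((hg.const_mul 2).mul hg'))).const_mul (2 / (1 - β)))
  have hftc := intervalIntegral.integral_eq_sub_of_hasDerivAt_of_le
    (f := fun s => 2 / (1 - β) * (s ^ (1 - β) * g s ^ 2)) hεT
    (((hpow (1 - β)).mul (hg.pow 2)).const_mul _) (fun s hs => by
      have h1 := Real.hasDerivAt_rpow_const (p := 1 - β)
        (Or.inl (hpos s (Ioo_subset_Icc_self hs)).ne')
      have h2 := ((h1.mul ((hderiv s hs).pow 2)).const_mul (2 / (1 - β)))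
      refine h2.congr_deriv ?_
      rw [show 1 - β - 1 = -β by ring]
      simp) hF
  have hmono := intervalIntegral.integral_mono_on hεT hA (hB.add hF) fun s hs => by
    have h0 := hpos s hs
    have e1 : s ^ (1 - β) = s ^ (-β) * s := by
      rw [← Real.rpow_add_one h0.ne']; congr 1; ring
    have e2 : s ^ (2 - β) = s ^ (-β) * s ^ 2 := by
      rw [← Real.rpow_add_natCast h0.ne']; congr 1; push_cast; ring
    have h3 : 0 ≤ s ^ (-β) * (g s + 2 / (1 - β) * (s * g' s)) ^ 2 := by positivity
    simp only [Pi.mul_apply, Pi.pow_apply, Pi.add_apply]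
    rw [e1, e2, ← sub_nonneg]
    refine h3.trans_eq ?_
    field_simp
    ring
  rw [intervalIntegral.integral_add hB hF, hftc] at hmono
  have hend : 0 ≤ 2 / (1 - β) * (ε ^ (1 - β) * g ε ^ 2) := by positivity
  simp only [hgT, Pi.mul_apply, Pi.pow_apply] at hmono
  norm_num at hmono
  rw [intervalIntegral.integral_const_mul]
  linarith

/-- **Hardy's inequality, derivative form.**
Let `0 < T < ∞` and `β < 1`, and let `h : (0, T] → [0, ∞)` be continuously differentiable
(with derivative `h'` on `(0, T]`).  Then
`∫_0^T s^(-β) (h(s) - h(T))² ds ≤ (4/(1-β)²) ∫_0^T s^(2-β) h'(s)² ds`,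
both sides being Lebesgue integrals with values in `[0, ∞]`. -/
theorem hardy_inequality_deriv (T : ℝ) (hT : 0 < T) (β : ℝ) (hβ : β < 1)
    (h h' : ℝ → ℝ)
    (hnonneg : ∀ s ∈ Ioc (0 : ℝ) T, 0 ≤ h s)
    (hderiv : ∀ s ∈ Ioc (0 : ℝ) T, HasDerivWithinAt h (h' s) (Ioc (0 : ℝ) T) s)
    (hcont : ContinuousOn h' (Ioc (0 : ℝ) T)) :
    (∫⁻ s in Ioc (0 : ℝ) T, ENNReal.ofReal (s ^ (-β) * (h s - h T) ^ 2))
      ≤ ENNReal.ofReal (4 / (1 - β) ^ 2) *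
        ∫⁻ s in Ioc (0 : ℝ) T, ENNReal.ofReal (s ^ (2 - β) * (h' s) ^ 2) := by
  have hunion : Ioc (0 : ℝ) T = ⋃ n : ℕ, Ioc (T / (n + 1)) T := by
    ext s
    simp only [mem_iUnion, mem_Ioc, exists_and_right, and_congr_left_iff]
    refine fun _ => ⟨fun hs => ?_, fun ⟨n, hn⟩ => lt_trans (by positivity) hn⟩
    obtain ⟨n, hn⟩ := exists_nat_gt (T / s)
    refine ⟨n, ?_⟩
    rw [div_lt_iff₀ hs] at hn
    rw [div_lt_iff₀ (by positivity)]
    nlinarith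
  have hdir : Directed (· ⊆ ·) fun n : ℕ => Ioc (T / ((n : ℝ) + 1)) T :=
    Monotone.directed_le fun m n hmn => Ioc_subset_Ioc_left <| by gcongr
  rw [← lintegral_const_mul' _ _ ENNReal.ofReal_ne_top]
  conv_lhs => rw [hunion, setLIntegral_iUnion_of_directed _ hdir]
  refine iSup_le fun n => ?_
  set ε : ℝ := T / (n + 1)
  have hε : 0 < ε := by positivity
  have hεT : ε ≤ T := div_le_self hT.le (by simp)
  have hIcc : Icc ε T ⊆ Ioc 0 T := fun s hs => ⟨hε.trans_le hs.1, hs.2⟩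
  have hg : ContinuousOn (fun s => h s - h T) (Icc ε T) :=
    (fun s hs => ((hderiv s (hIcc hs)).continuousWithinAt.mono hIcc).sub
      continuousWithinAt_const)
  have hg' := hcont.mono hIcc
  have hmain := intervalIntegral_hardy_le hε hεT hβ (g := fun s => h s - h T) (sub_self _) hg
    (fun s hs => ((hderiv s (hIcc (Ioo_subset_Icc_self hs))).hasDerivAt
      (Ioc_mem_nhds (hε.trans hs.1) hs.2)).sub_const _) hg'
  rw [intervalIntegral.integral_of_le hεT, intervalIntegral.integral_of_le hεT] at hmain
  have hpow : ∀ p : ℝ, ContinuousOn (fun s : ℝ => s ^ p) (Icc ε T) := fun p =>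
    continuousOn_id.rpow_const fun s hs => Or.inl (hIcc hs).1.ne'
  have hinteg : ∀ f : ℝ → ℝ, ContinuousOn f (Icc ε T) → IntegrableOn f (Ioc ε T) :=
    fun f hf => hf.integrableOn_Icc.mono_set Ioc_subset_Icc_self
  have hnn : ∀ f : ℝ → ℝ, (∀ s, 0 < s → 0 ≤ f s) → 0 ≤ᵐ[volume.restrict (Ioc ε T)] f :=
    fun f hf => ae_restrict_of_forall_mem measurableSet_Ioc fun s hs => hf s (hε.trans hs.1)
  have hle := ENNReal.ofReal_le_ofReal hmain
  rw [ofReal_integral_eq_lintegral_ofReal (f := fun s => s ^ (-β) * (h s - h T) ^ 2)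
      (hinteg _ ((hpow _).mul (hg.pow 2))) (hnn _ fun s hs => by positivity),
    ofReal_integral_eq_lintegral_ofReal
      (f := fun s => 4 / (1 - β) ^ 2 * (s ^ (2 - β) * h' s ^ 2))
      (hinteg _ (((hpow _).mul (hg'.pow 2)).const_mul _))
      (hnn _ fun s hs => by positivity)] at hle
  refine hle.trans ?_
  simp_rw [ENNReal.ofReal_mul (show 0 ≤ 4 / (1 - β) ^ 2 by positivity)]
  exact lintegral_mono_set (Ioc_subset_Ioc_left hε.le)
end

section
/- Let 0 < t < ∞ and -∞ < b < 1. Suppose f, g, h : (0, t] → [0, ∞) are continuous, f is differentiable on (0, t], and f'(s) + g(s) ≤ h(s) for all 0 < s ≤ t. Assume moreover that ∫_0^t s^{-b} f(s) ds < ∞. Then t^{1-b} f(t) + ∫_0^t s^{1-b} g(s) ds ≤ ∫_0^t s^{1-b} h(s) ds + (1-b) ∫_0^t s^{-b} f(s) ds. -/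
open MeasureTheory Set
open scoped ENNReal

/-- Integrated form of `u' + p ≤ q` on a compact interval, for continuous `p, q ≥ 0`. -/
lemma ofReal_add_lintegral_le_of_deriv_add_le {a t : ℝ} (hat : a ≤ t) {u u' p q : ℝ → ℝ}
    (hu : ContinuousOn u (Icc a t)) (hp : ContinuousOn p (Icc a t))
    (hq : ContinuousOn q (Icc a t))
    (hp0 : ∀ s ∈ Icc a t, 0 ≤ p s) (hq0 : ∀ s ∈ Icc a t, 0 ≤ q s)
    (hu0 : ∀ s ∈ Icc a t, 0 ≤ u s)
    (hderiv : ∀ s ∈ Ioo a t, HasDerivAt u (u' s) s)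
    (hineq : ∀ s ∈ Ioo a t, u' s + p s ≤ q s) :
    ENNReal.ofReal (u t) + (∫⁻ s in Ioc a t, ENNReal.ofReal (p s))
      ≤ (∫⁻ s in Ioc a t, ENNReal.ofReal (q s)) + ENNReal.ofReal (u a) := by
  have hpi : IntegrableOn p (Icc a t) := hp.integrableOn_Icc
  have hqi : IntegrableOn q (Icc a t) := hq.integrableOn_Icc
  have key : u t - u a ≤ ∫ s in a..t, (q s - p s) :=
    intervalIntegral.sub_le_integral_of_hasDeriv_right_of_le hat hu
      (fun s hs => (hderiv s hs).hasDerivWithinAt) (hqi.sub hpi)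
      (fun s hs => by linarith [hineq s hs])
  rw [intervalIntegral.integral_of_le hat,
    integral_sub (hqi.mono_set Ioc_subset_Icc_self) (hpi.mono_set Ioc_subset_Icc_self)] at key
  have nonneg_ae : ∀ {r : ℝ → ℝ}, (∀ s ∈ Icc a t, 0 ≤ r s) →
      0 ≤ᵐ[volume.restrict (Ioc a t)] r := fun hr =>
    (ae_restrict_iff' measurableSet_Ioc).2 (ae_of_all _ fun s hs => hr s (Ioc_subset_Icc_self hs))
  rw [← ofReal_integral_eq_lintegral_ofReal (hpi.mono_set Ioc_subset_Icc_self) (nonneg_ae hp0),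
    ← ofReal_integral_eq_lintegral_ofReal (hqi.mono_set Ioc_subset_Icc_self) (nonneg_ae hq0),
    ← ENNReal.ofReal_add (hu0 t (right_mem_Icc.2 hat)) (integral_nonneg_of_ae (nonneg_ae hp0)),
    ← ENNReal.ofReal_add (integral_nonneg_of_ae (nonneg_ae hq0)) (hu0 a (left_mem_Icc.2 hat))]
  exact ENNReal.ofReal_le_ofReal (by linarith)

/-- If `v` has finite integral near `0`, then `s * v s` takes arbitrarily small values near `0`. -/
lemma exists_mul_lt_of_lintegral_lt_top {δ c : ℝ} (hδ : 0 < δ) (hc : 0 < c) {v : ℝ → ℝ}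
    (hv : (∫⁻ s in Ioc 0 δ, ENNReal.ofReal (v s)) < ⊤) :
    ∃ s ∈ Ioc 0 δ, s * v s < c := by
  by_contra! H
  have hle : (∫⁻ s in Ioc 0 δ, ENNReal.ofReal (c * s⁻¹)) < ⊤ := by
    refine (setLIntegral_mono' measurableSet_Ioc fun s hs => ?_).trans_lt hv
    refine ENNReal.ofReal_le_ofReal ?_
    rw [← div_eq_mul_inv, div_le_iff₀ hs.1, mul_comm]
    exact H s hs
  have hint : IntegrableOn (fun s : ℝ => c * s⁻¹) (Ioc 0 δ) := by
    refine ⟨by fun_prop, ?_⟩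
    rw [hasFiniteIntegral_iff_ofReal]
    · exact hle
    · exact (ae_restrict_iff' measurableSet_Ioc).2
        (ae_of_all _ fun s hs => mul_nonneg hc.le (inv_nonneg.2 hs.1.le))
  have hinv : IntervalIntegrable (fun s : ℝ => s⁻¹) volume 0 δ := by
    rw [intervalIntegrable_iff_integrableOn_Ioc_of_le hδ.le]
    simpa [IntegrableOn, hc.ne'] using hint.const_mul c⁻¹
  rw [intervalIntegrable_inv_iff] at hinv
  rcases hinv with h | h
  · exact hδ.ne h
  · exact h left_mem_uIcc

/-- Let `0 < t < ∞` and `b < 1`.  Suppose `f, g, h : (0, t] → [0, ∞)` are continuous, `f` is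
differentiable on `(0, t]` with derivative `f'`, and `f'(s) + g(s) ≤ h(s)` for `0 < s ≤ t`.
If `∫_0^t s^(-b) f(s) ds < ∞`, then
`t^(1-b) f(t) + ∫_0^t s^(1-b) g(s) ds ≤ ∫_0^t s^(1-b) h(s) ds + (1-b) ∫_0^t s^(-b) f(s) ds`,
all integrals being Lebesgue integrals with values in `[0, ∞]`. -/
theorem weighted_differential_inequality (t : ℝ) (ht : 0 < t) (b : ℝ) (hb : b < 1)
    (f g h f' : ℝ → ℝ)
    (hf0 : ∀ s ∈ Ioc (0 : ℝ) t, 0 ≤ f s)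
    (hg0 : ∀ s ∈ Ioc (0 : ℝ) t, 0 ≤ g s)
    (hh0 : ∀ s ∈ Ioc (0 : ℝ) t, 0 ≤ h s)
    (hfc : ContinuousOn f (Ioc (0 : ℝ) t))
    (hgc : ContinuousOn g (Ioc (0 : ℝ) t))
    (hhc : ContinuousOn h (Ioc (0 : ℝ) t))
    (hderiv : ∀ s ∈ Ioc (0 : ℝ) t, HasDerivWithinAt f (f' s) (Ioc (0 : ℝ) t) s)
    (hineq : ∀ s ∈ Ioc (0 : ℝ) t, f' s + g s ≤ h s)
    (hfin : (∫⁻ s in Ioc (0 : ℝ) t, ENNReal.ofReal (s ^ (-b) * f s)) < ⊤) :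
    ENNReal.ofReal (t ^ (1 - b) * f t)
        + (∫⁻ s in Ioc (0 : ℝ) t, ENNReal.ofReal (s ^ (1 - b) * g s))
      ≤ (∫⁻ s in Ioc (0 : ℝ) t, ENNReal.ofReal (s ^ (1 - b) * h s))
        + ENNReal.ofReal (1 - b) *
            ∫⁻ s in Ioc (0 : ℝ) t, ENNReal.ofReal (s ^ (-b) * f s) := by
  have hb' : 0 ≤ 1 - b := by linarith
  have hweight : ∀ r : ℝ, ∀ k : ℝ → ℝ, ContinuousOn k (Ioc 0 t) →
      ContinuousOn (fun s => s ^ r * k s) (Ioc 0 t) := fun r k hk =>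
    (continuousOn_id.rpow_const fun s hs => Or.inl hs.1.ne').mul hk
  have hgm := hweight (1 - b) g hgc
  have hhm := hweight (1 - b) h hhc
  have hfm := hweight (-b) f hfc
  have hterm0 : ∀ r : ℝ, ∀ k : ℝ → ℝ, (∀ s ∈ Ioc (0 : ℝ) t, 0 ≤ k s) →
      ∀ s ∈ Ioc (0 : ℝ) t, 0 ≤ s ^ r * k s := fun r k hk s hs =>
    mul_nonneg (Real.rpow_nonneg hs.1.le r) (hk s hs)
  have hrhs : (∫⁻ s in Ioc 0 t,
        ENNReal.ofReal (s ^ (1 - b) * h s + (1 - b) * (s ^ (-b) * f s)))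
      = (∫⁻ s in Ioc (0 : ℝ) t, ENNReal.ofReal (s ^ (1 - b) * h s))
        + ENNReal.ofReal (1 - b) * ∫⁻ s in Ioc (0 : ℝ) t, ENNReal.ofReal (s ^ (-b) * f s) := by
    rw [← lintegral_const_mul' _ _ ENNReal.ofReal_ne_top,
      ← lintegral_add_left' (hhm.aemeasurable measurableSet_Ioc).ennreal_ofReal]
    refine setLIntegral_congr_fun measurableSet_Ioc fun s hs => ?_
    rw [ENNReal.ofReal_add (hterm0 _ h hh0 s hs) (mul_nonneg hb' (hterm0 _ f hf0 s hs)),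
      ENNReal.ofReal_mul hb']
  rw [← hrhs]
  have htrunc : ∀ a ∈ Ioc 0 t,
      ENNReal.ofReal (t ^ (1 - b) * f t)
          + (∫⁻ s in Ioc a t, ENNReal.ofReal (s ^ (1 - b) * g s))
        ≤ (∫⁻ s in Ioc 0 t,
            ENNReal.ofReal (s ^ (1 - b) * h s + (1 - b) * (s ^ (-b) * f s)))
          + ENNReal.ofReal (a ^ (1 - b) * f a) := by
    intro a ha
    have hsub : Icc a t ⊆ Ioc 0 t := fun s hs => ⟨ha.1.trans_le hs.1, hs.2⟩
    refine (ofReal_add_lintegral_le_of_deriv_add_le (u := fun s => s ^ (1 - b) * f s)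
      (u' := fun s => (1 - b) * s ^ (-b) * f s + s ^ (1 - b) * f' s)
      (q := fun s => s ^ (1 - b) * h s + (1 - b) * (s ^ (-b) * f s)) ha.2
      ((hweight (1 - b) f hfc).mono hsub) (hgm.mono hsub)
      ((hhm.add (hfm.const_mul (1 - b))).mono hsub)
      (fun s hs => hterm0 _ g hg0 s (hsub hs))
      (fun s hs => add_nonneg (hterm0 _ h hh0 s (hsub hs))
        (mul_nonneg hb' (hterm0 _ f hf0 s (hsub hs))))
      (fun s hs => hterm0 _ f hf0 s (hsub hs)) (fun s hs => ?_) (fun s hs => ?_)).trans ?_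
    · have hs0 : 0 < s := ha.1.trans hs.1
      have hf' := (hderiv s ⟨hs0, hs.2.le⟩).hasDerivAt (Ioc_mem_nhds hs0 hs.2)
      have hw := Real.hasDerivAt_rpow_const (x := s) (p := 1 - b) (Or.inl hs0.ne')
      rw [show 1 - b - 1 = -b by ring] at hw
      exact hw.mul hf'
    · have hs' := hsub (Ioo_subset_Icc_self hs)
      have := mul_le_mul_of_nonneg_left (hineq s hs') (Real.rpow_nonneg hs'.1.le (1 - b))
      linarith
    · gcongr
      exact ha.1.le
  have hbound : ∀ δ ∈ Ioc 0 t,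
      ENNReal.ofReal (t ^ (1 - b) * f t)
          + (∫⁻ s in Ioc δ t, ENNReal.ofReal (s ^ (1 - b) * g s))
        ≤ ∫⁻ s in Ioc 0 t,
            ENNReal.ofReal (s ^ (1 - b) * h s + (1 - b) * (s ^ (-b) * f s)) := by
    intro δ hδ
    refine ENNReal.le_of_forall_pos_le_add fun c hc _ => ?_
    obtain ⟨a, ha, hac⟩ := exists_mul_lt_of_lintegral_lt_top hδ.1 (NNReal.coe_pos.2 hc)
      ((lintegral_mono_set (Ioc_subset_Ioc_right hδ.2)).trans_lt hfin)
    have hua : a ^ (1 - b) * f a ≤ c := by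
      rw [sub_eq_add_neg, Real.rpow_add ha.1, Real.rpow_one, mul_assoc]
      exact hac.le
    calc _ ≤ ENNReal.ofReal (t ^ (1 - b) * f t)
          + (∫⁻ s in Ioc a t, ENNReal.ofReal (s ^ (1 - b) * g s)) := by
          gcongr
          exact ha.2
      _ ≤ _ := htrunc a ⟨ha.1, ha.2.trans hδ.2⟩
      _ ≤ _ := by
          gcongr
          exact ENNReal.ofReal_le_of_le_toReal hua
  have hcover : AECover (volume.restrict (Ioc 0 t)) (nhdsWithin (0 : ℝ) (Ioi 0))
      (fun δ => Ioc δ t) :=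
    aecover_Ioc_of_Ioc (tendsto_nhdsWithin_of_tendsto_nhds Filter.tendsto_id) tendsto_const_nhds
  have hlim := hcover.lintegral_tendsto_of_countably_generated
    (hgm.aemeasurable measurableSet_Ioc).ennreal_ofReal
  refine le_of_tendsto (hlim.const_add (ENNReal.ofReal (t ^ (1 - b) * f t))) ?_
  filter_upwards [Ioc_mem_nhdsGT ht] with δ hδ
  rw [Measure.restrict_restrict_of_subset (Ioc_subset_Ioc_left hδ.1.le)]
  exact hbound δ hδ
end

section
/- Let 0 < T < ∞. Let β : (0, T) → [0, ∞) be measurable with ∫_0^T t β(t)² dt < ∞. Let f : [0, T] → [0, ∞) be continuous, differentiable on (0, T), and satisfy f'(t) ≤ β(t) f(t) for all 0 < t < T. If t^{-1/2} f(t) → 0 as t ↓ 0, then f(t) = 0 for all t ∈ [0, T]. -/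
open MeasureTheory Set Filter
open scoped ENNReal Topology

/-- If `u ≥ 0` satisfies `u' ≤ k u` on `(0, T)` with `k ≥ 0` integrable, and `u(t) → 0` as `t ↓ 0`,
then `u` vanishes on `(0, T)`. -/
theorem eq_zero_of_hasDerivAt_le_mul_of_integrableOn {T : ℝ} {k u u' : ℝ → ℝ}
    (hk : IntegrableOn k (Ioo 0 T)) (hk0 : ∀ t ∈ Ioo 0 T, 0 ≤ k t)
    (hu0 : ∀ t ∈ Ioo 0 T, 0 ≤ u t) (hderiv : ∀ t ∈ Ioo 0 T, HasDerivAt u (u' t) t)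
    (hineq : ∀ t ∈ Ioo 0 T, u' t ≤ k t * u t) (hlim : Tendsto u (𝓝[>] 0) (𝓝 0)) :
    ∀ t ∈ Ioo 0 T, u t = 0 := by
  intro t ht
  set K := ∫ x in Ioo 0 T, k x
  have key : ∀ ε > 0, ∀ s ∈ Ioo 0 t, u t + ε ≤ (u s + ε) * Real.exp K := by
    intro ε hε s hs
    have hsub : Icc s t ⊆ Ioo 0 T := fun x hx => ⟨hs.1.trans_le hx.1, hx.2.trans_lt ht.2⟩
    have hpos : ∀ x ∈ Icc s t, 0 < u x + ε := fun x hx => by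
      have := hu0 x (hsub hx)
      positivity
    have hlog : ∀ x ∈ Icc s t,
        HasDerivAt (fun y => Real.log (u y + ε)) (u' x / (u x + ε)) x := fun x hx =>
      ((hderiv x (hsub hx)).add_const ε).log (hpos x hx).ne'
    have hle := intervalIntegral.sub_le_integral_of_hasDeriv_right_of_le hs.2.le
      (fun x hx => (hlog x hx).continuousAt.continuousWithinAt)
      (fun x hx => (hlog x (Ioo_subset_Icc_self hx)).hasDerivWithinAt)
      (hk.mono_set hsub) (fun x hx => by
        have hx' := Ioo_subset_Icc_self hx
        rw [div_le_iff₀ (hpos x hx')]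
        nlinarith [hineq x (hsub hx'), mul_nonneg (hk0 x (hsub hx')) hε.le])
    have hK : ∫ x in s..t, k x ≤ K := by
      rw [intervalIntegral.integral_of_le hs.2.le]
      exact setIntegral_mono_set hk
        ((ae_restrict_iff' measurableSet_Ioo).2 (ae_of_all _ hk0))
        (Ioc_subset_Icc_self.trans hsub).eventuallyLE
    have hst := hpos s (left_mem_Icc.2 hs.2.le)
    have htt := hpos t (right_mem_Icc.2 hs.2.le)
    rw [← Real.log_le_log_iff htt (by positivity), Real.log_mul hst.ne' (Real.exp_ne_zero K),
      Real.log_exp]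
    linarith
  have hε : ∀ ε > 0, u t + ε ≤ ε * Real.exp K := by
    intro ε hε
    have h : Tendsto (fun s => (u s + ε) * Real.exp K) (𝓝[>] 0) (𝓝 ((0 + ε) * Real.exp K)) :=
      (hlim.add_const ε).mul_const _
    rw [zero_add] at h
    exact ge_of_tendsto h (eventually_of_mem (Ioo_mem_nhdsGT ht.1) (key ε hε))
  have h1 : Tendsto (fun ε : ℝ => ε * Real.exp K) (𝓝[>] 0) (𝓝 (0 * Real.exp K)) :=
    (tendsto_nhdsWithin_of_tendsto_nhds tendsto_id).mul_const _
  rw [zero_mul] at h1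
  refine le_antisymm (ge_of_tendsto h1 ?_) (hu0 t ht)
  filter_upwards [self_mem_nhdsWithin] with ε hpos
  linarith [hε ε hpos, mem_Ioi.1 hpos]

/-- **Gronwall-type uniqueness lemma with singular coefficient.**
Let `0 < T < ∞`.  Let `β : (0, T) → [0, ∞)` be measurable with `∫_0^T t β(t)² dt < ∞`.
Let `f : [0, T] → [0, ∞)` be continuous, differentiable on `(0, T)` with derivative `f'`,
and satisfy `f'(t) ≤ β(t) f(t)` for all `0 < t < T`.  If `t^(-1/2) f(t) → 0` as `t ↓ 0`,
then `f(t) = 0` for all `t ∈ [0, T]`. -/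
theorem gronwall_singular_uniqueness (T : ℝ) (hT : 0 < T)
    (β f f' : ℝ → ℝ)
    (hβmeas : Measurable β)
    (hβ0 : ∀ t ∈ Ioo (0 : ℝ) T, 0 ≤ β t)
    (hβint : (∫⁻ t in Ioo (0 : ℝ) T, ENNReal.ofReal (t * (β t) ^ 2)) < ⊤)
    (hfc : ContinuousOn f (Icc (0 : ℝ) T))
    (hf0 : ∀ t ∈ Icc (0 : ℝ) T, 0 ≤ f t)
    (hderiv : ∀ t ∈ Ioo (0 : ℝ) T, HasDerivAt f (f' t) t)
    (hineq : ∀ t ∈ Ioo (0 : ℝ) T, f' t ≤ β t * f t)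
    (hlim : Tendsto (fun t : ℝ => t ^ (-(1 / 2) : ℝ) * f t) (𝓝[>] 0) (𝓝 0)) :
    ∀ t ∈ Icc (0 : ℝ) T, f t = 0 := by
  have hmeas : Measurable fun t : ℝ => t * (β t) ^ 2 := measurable_id.mul (hβmeas.pow_const 2)
  have hnonneg : ∀ t ∈ Ioo (0 : ℝ) T, 0 ≤ t * (β t) ^ 2 := fun t ht =>
    mul_nonneg ht.1.le (sq_nonneg _)
  have hint : IntegrableOn (fun t : ℝ => t * (β t) ^ 2) (Ioo 0 T) :=
    ⟨hmeas.aestronglyMeasurable, (hasFiniteIntegral_iff_ofReal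
      ((ae_restrict_iff' measurableSet_Ioo).2 (ae_of_all _ hnonneg))).2 hβint⟩
  have hzero : ∀ t ∈ Ioo (0 : ℝ) T, t ^ (-(1 / 2) : ℝ) * f t = 0 := by
    refine eq_zero_of_hasDerivAt_le_mul_of_integrableOn (hint.div_const 2)
      (fun t ht => div_nonneg (hnonneg t ht) zero_le_two)
      (fun t ht => mul_nonneg (Real.rpow_nonneg ht.1.le _) (hf0 t (Ioo_subset_Icc_self ht)))
      (fun t ht => (Real.hasDerivAt_rpow_const (Or.inl ht.1.ne')).mul (hderiv t ht))
      (fun t ht => ?_) hlim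
    have ht0 : 0 < t := ht.1
    have hf := hf0 t (Ioo_subset_Icc_self ht)
    have hyoung : β t ≤ t * (β t) ^ 2 / 2 + 1 / (2 * t) := by
      have h : t * (β t) ^ 2 / 2 + 1 / (2 * t) - β t = (t * β t - 1) ^ 2 / (2 * t) := by
        field_simp
        ring
      have : 0 ≤ (t * β t - 1) ^ 2 / (2 * t) := by positivity
      linarith
    have hle : f' t ≤ (t * (β t) ^ 2 / 2 + 1 / (2 * t)) * f t :=
      (hineq t ht).trans (mul_le_mul_of_nonneg_right hyoung hf)
    rw [Real.rpow_sub_one ht0.ne']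
    have hmul := mul_le_mul_of_nonneg_left hle (Real.rpow_nonneg ht0.le (-(1 / 2) : ℝ))
    calc _ ≤ -(1 / 2) * (t ^ (-(1 / 2) : ℝ) / t) * f t
          + t ^ (-(1 / 2) : ℝ) * ((t * (β t) ^ 2 / 2 + 1 / (2 * t)) * f t) := by gcongr
      _ = _ := by
        field_simp
        ring
  have heq : EqOn f 0 (Ioo 0 T) := fun t ht =>
    (mul_eq_zero.1 (hzero t ht)).resolve_left (Real.rpow_pos_of_pos ht.1 _).ne'
  exact heq.of_subset_closure hfc continuousOn_const Ioo_subset_Icc_self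
    (closure_Ioo hT.ne).ge
end
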